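/- arXiv:2511.20519 — 2 statements merged into one kernel-verified Lean document; each statement's English description precedes it below -/
import Mathlib

section
/- Let (d_n, k_n) be a sequence of admissible dimension pairs with d_n → ∞, and suppose k_n/d_n → 1/2 and limsup_{n→∞} d_n^{-1} (2k_n - d_n - 1)^{d_n/k_n} < eπ. For each n let μ_n be a probability measure on ℝ whose characteristic function is φ_n(t) = exp( ∫_0^1 ( e^{i t x/σ_{d_n,k_n}} − 1 − i t x/σ_{d_n,k_n} ) f_{d_n,k_n}(x) dx ) for all t ∈ ℝ. Then μ_n converges weakly to the standard Gaussian measure N(0,1) on ℝ as n → ∞. -/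
open MeasureTheory ProbabilityTheory Filter

/-- The characteristic function of a measure on `ℝ`. -/
noncomputable def charFn (μ : Measure ℝ) (t : ℝ) : ℂ :=
  ∫ x, Complex.exp (Complex.I * t * x) ∂μ

/-- The Lévy density `f_{d,k}(x) = (ω_{d−k}/(k−1)) x^{−1−(d−1)/(k−1)} (1−x^{2/(k−1)})^{(d−k)/2−1}`
on `(0,1)`, where `ω_b = 2π^{b/2}/Γ(b/2)`. -/
noncomputable def levyDensity (d k : ℕ) (x : ℝ) : ℝ :=
  2 * Real.pi ^ (((d : ℝ) - k) / 2) / Real.Gamma (((d : ℝ) - k) / 2) / ((k : ℝ) - 1) *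
    x ^ (-1 - ((d : ℝ) - 1) / ((k : ℝ) - 1)) *
    (1 - x ^ (2 / ((k : ℝ) - 1))) ^ (((d : ℝ) - k) / 2 - 1)

/-- The variance `σ_{d,k}² = ∫_0^1 x² f_{d,k}(x) dx` of the limit random variable `Z_{d,k}`. -/
noncomputable def sigmaSqHyp (d k : ℕ) : ℝ :=
  ∫ x in Set.Ioo (0 : ℝ) 1, x ^ 2 * levyDensity d k x

/-- `σ_{d,k} = (σ_{d,k}²)^{1/2}`. -/
noncomputable def sigmaHyp (d k : ℕ) : ℝ :=
  Real.sqrt (sigmaSqHyp d k)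

lemma betaWeight_moment {p q : ℝ} (hp : 0 < p) (hq : 0 < q) :
    IntegrableOn (fun w : ℝ => w ^ (p - 1) * (1 - w) ^ (q - 1)) (Set.Ioo 0 1) ∧
      ∫ w in Set.Ioo (0 : ℝ) 1, w ^ (p - 1) * (1 - w) ^ (q - 1) = beta p q := by
  have hB := beta_pos hp hq
  have h1 := lintegral_betaPDF_eq_one hp hq
  rw [lintegral_betaPDF] at h1
  have hmeas : AEStronglyMeasurable
      (fun w : ℝ => 1 / beta p q * w ^ (p - 1) * (1 - w) ^ (q - 1))
      (volume.restrict (Set.Ioo 0 1)) := by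
    apply Measurable.aestronglyMeasurable
    fun_prop
  have hnn : 0 ≤ᵐ[volume.restrict (Set.Ioo (0 : ℝ) 1)]
      (fun w : ℝ => 1 / beta p q * w ^ (p - 1) * (1 - w) ^ (q - 1)) := by
    filter_upwards [ae_restrict_mem measurableSet_Ioo] with w hw
    have h0 := hw.1
    have h1 : 0 < 1 - w := by linarith [hw.2]
    simp only [Pi.zero_apply]
    positivity
  have hint : IntegrableOn (fun w : ℝ => 1 / beta p q * w ^ (p - 1) * (1 - w) ^ (q - 1))
      (Set.Ioo 0 1) := by
    refine ⟨hmeas, ?_⟩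
    rw [hasFiniteIntegral_iff_ofReal hnn, h1]
    exact ENNReal.one_lt_top
  have hval : ∫ w in Set.Ioo (0 : ℝ) 1, 1 / beta p q * w ^ (p - 1) * (1 - w) ^ (q - 1) = 1 := by
    rw [integral_eq_lintegral_of_nonneg_ae hnn hmeas, h1, ENNReal.toReal_one]
  have heq : (fun w : ℝ => w ^ (p - 1) * (1 - w) ^ (q - 1)) =
      fun w => beta p q * (1 / beta p q * w ^ (p - 1) * (1 - w) ^ (q - 1)) := by
    funext w
    field_simp
  rw [heq]
  exact ⟨hint.const_mul _, by rw [integral_const_mul, hval, mul_one]⟩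

lemma beta_add_one {p q : ℝ} (hp : 0 < p) (hq : 0 < q) :
    beta (p + 1) q = p / (p + q) * beta p q := by
  have := (Real.Gamma_pos_of_pos (add_pos hp hq)).ne'
  rw [beta, beta, Real.Gamma_add_one hp.ne', show p + 1 + q = p + q + 1 by ring,
    Real.Gamma_add_one (by positivity)]
  field_simp

/-- Substituting `w = x ^ (2 / (k - 1))` turns `x ^ 2 * levyDensity d k x` into a beta density. -/
lemma sq_mul_levyDensity_moment {d k : ℕ} (hk : 1 < k) (hkd : k < d) (hdk : d + 1 < 2 * k)
    (j : ℕ) :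
    IntegrableOn (fun x : ℝ => x ^ 2 * levyDensity d k x * (x ^ (2 / ((k : ℝ) - 1))) ^ j)
        (Set.Ioo 0 1) ∧
      ∫ x in Set.Ioo (0 : ℝ) 1, x ^ 2 * levyDensity d k x * (x ^ (2 / ((k : ℝ) - 1))) ^ j =
        Real.pi ^ (((d : ℝ) - k) / 2) / Real.Gamma (((d : ℝ) - k) / 2) *
          beta ((2 * (k : ℝ) - d - 1) / 2 + j) (((d : ℝ) - k) / 2) := by
  have hK : (0 : ℝ) < (k : ℝ) - 1 := by
    have : (1 : ℝ) < k := by exact_mod_cast hk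
    linarith
  have hq : (0 : ℝ) < ((d : ℝ) - k) / 2 := by
    have : (k : ℝ) < d := by exact_mod_cast hkd
    linarith
  have hp : (0 : ℝ) < (2 * (k : ℝ) - d - 1) / 2 := by
    have : (d : ℝ) + 1 < 2 * k := by exact_mod_cast hdk
    linarith
  have hpj : (0 : ℝ) < (2 * (k : ℝ) - d - 1) / 2 + j := by positivity
  set r := 2 / ((k : ℝ) - 1) with hr
  have hr0 : 0 < r := by positivity
  set q := ((d : ℝ) - k) / 2 with hqdef
  set p := (2 * (k : ℝ) - d - 1) / 2 with hpdef
  set c := Real.pi ^ q / Real.Gamma q with hc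
  obtain ⟨hbi, hbv⟩ := betaWeight_moment hpj hq
  set g : ℝ → ℝ := (Set.Ioo (0 : ℝ) 1).indicator
    (fun w : ℝ => w ^ (p + j - 1) * (1 - w) ^ (q - 1)) with hg
  have hgi : IntegrableOn g (Set.Ioi 0) := by
    rw [hg]
    exact (hbi.integrable_indicator measurableSet_Ioo).integrableOn
  have hgv : ∫ w in Set.Ioi (0 : ℝ), g w = beta (p + j) q := by
    rw [hg, setIntegral_indicator measurableSet_Ioo,
      Set.inter_eq_right.2 Set.Ioo_subset_Ioi_self, hbv]
  have hci := (integrableOn_Ioi_comp_rpow_iff g hr0.ne').2 hgi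
  have hcv := integral_comp_rpow_Ioi_of_pos (g := g) hr0
  rw [hgv] at hcv
  have key : Set.EqOn (fun x : ℝ => c * ((r * x ^ (r - 1)) • g (x ^ r)))
      ((Set.Ioo (0 : ℝ) 1).indicator
        (fun x : ℝ => x ^ 2 * levyDensity d k x * (x ^ r) ^ j)) (Set.Ioi 0) := by
    intro x hx
    have hx0 : (0 : ℝ) < x := hx
    by_cases hx1 : x < 1
    · have hxr : x ^ r ∈ Set.Ioo (0 : ℝ) 1 :=
        ⟨Real.rpow_pos_of_pos hx0 _, Real.rpow_lt_one hx0.le hx1 hr0⟩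
      have h2 : x ^ (r - 1) * (x ^ r) ^ (p + j - 1) =
          x ^ 2 * x ^ (-1 - ((d : ℝ) - 1) / ((k : ℝ) - 1)) * (x ^ r) ^ j := by
        rw [← Real.rpow_natCast x 2, ← Real.rpow_natCast (x ^ r) j, ← Real.rpow_mul hx0.le,
          ← Real.rpow_mul hx0.le, ← Real.rpow_add hx0, ← Real.rpow_add hx0, ← Real.rpow_add hx0]
        congr 1
        rw [hr, hpdef]
        push_cast
        field_simp
        ring
      have hx' : x ∈ Set.Ioo (0 : ℝ) 1 := ⟨hx0, hx1⟩
      simp only [Set.indicator_of_mem hx', hg, Set.indicator_of_mem hxr, smul_eq_mul, levyDensity]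
      rw [← hqdef, ← hr]
      calc c * (r * x ^ (r - 1) * ((x ^ r) ^ (p + j - 1) * (1 - x ^ r) ^ (q - 1)))
          = c * r * (x ^ (r - 1) * (x ^ r) ^ (p + j - 1)) * (1 - x ^ r) ^ (q - 1) := by ring
        _ = _ := by
          rw [h2, hc, hr]
          ring
    · have hx1' : 1 ≤ x := not_lt.1 hx1
      have hxr : x ^ r ∉ Set.Ioo (0 : ℝ) 1 := fun h =>
        absurd h.2 (not_lt.2 (Real.one_le_rpow hx1' hr0.le))
      have hx' : x ∉ Set.Ioo (0 : ℝ) 1 := fun h => hx1 h.2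
      simp [Set.indicator_of_notMem hx', hg, Set.indicator_of_notMem hxr]
  constructor
  · have h3 : IntegrableOn (fun x : ℝ => c * ((r * x ^ (r - 1)) • g (x ^ r))) (Set.Ioi 0) := by
      refine Integrable.const_mul ?_ c
      rwa [abs_of_pos hr0] at hci
    have h4 := h3.congr_fun key measurableSet_Ioi
    have h5 := h4.mono_set (Set.Ioo_subset_Ioi_self : Set.Ioo (0 : ℝ) 1 ⊆ Set.Ioi 0)
    exact h5.congr_fun (fun x hx => Set.indicator_of_mem hx _) measurableSet_Ioo
  · have h3 := setIntegral_congr_fun (μ := volume) measurableSet_Ioi key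
    rw [setIntegral_indicator measurableSet_Ioo,
      Set.inter_eq_right.2 Set.Ioo_subset_Ioi_self] at h3
    rw [← h3, integral_const_mul, hcv]

lemma log_Gamma_half_le {N : ℕ} (hN : 4 ≤ N) :
    Real.log (Real.Gamma ((N : ℝ) / 2)) ≤
      (N : ℝ) / 2 * (Real.log N - 1 - Real.log 2) + 2 := by
  have hN' : (4 : ℝ) ≤ N := by exact_mod_cast hN
  have hN0 : (0 : ℝ) < N := by linarith
  have hG : 0 < Real.Gamma ((N : ℝ) / 2) := Real.Gamma_pos_of_pos (by positivity)
  have hmono : Real.Gamma ((N : ℝ) / 2) ≤ Real.Gamma ((N : ℝ) / 2 + 1 / 2) :=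
    Real.Gamma_strictMonoOn_Ici.monotoneOn (Set.mem_Ici.2 (by linarith))
      (Set.mem_Ici.2 (by linarith)) (by linarith)
  have hdup := Real.Gamma_mul_Gamma_add_half ((N : ℝ) / 2)
  rw [show 2 * ((N : ℝ) / 2) = N by ring] at hdup
  obtain ⟨M, rfl⟩ : ∃ M, N = M + 1 := ⟨N - 1, by omega⟩
  have hGM : Real.Gamma ((M + 1 : ℕ) : ℝ) = (M.factorial : ℝ) := by
    push_cast
    exact Real.Gamma_nat_eq_factorial M
  have hM0 : (0 : ℝ) < M.factorial := by exact_mod_cast M.factorial_pos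
  have hle : 2 * Real.log (Real.Gamma (((M + 1 : ℕ) : ℝ) / 2)) ≤
      Real.log M.factorial + (1 - ((M + 1 : ℕ) : ℝ)) * Real.log 2 + Real.log Real.pi / 2 := by
    calc 2 * Real.log (Real.Gamma (((M + 1 : ℕ) : ℝ) / 2))
        ≤ Real.log (Real.Gamma (((M + 1 : ℕ) : ℝ) / 2)) +
          Real.log (Real.Gamma (((M + 1 : ℕ) : ℝ) / 2 + 1 / 2)) := by
          linarith [Real.log_le_log hG hmono]
      _ = _ := by
          rw [← Real.log_mul hG.ne' (hG.trans_le hmono).ne', hdup, hGM,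
            Real.log_mul (by positivity) (by positivity), Real.log_mul (by positivity)
            (by positivity), Real.log_rpow (by norm_num), Real.log_sqrt Real.pi_pos.le]
  have hst := Stirling.stirlingSeq'_antitone (Nat.zero_le M)
  have hst' := Real.log_le_log (Stirling.stirlingSeq'_pos M) hst
  simp only [Function.comp_apply, Nat.succ_eq_add_one, zero_add] at hst'
  rw [Stirling.stirlingSeq_one, Stirling.log_stirlingSeq_formula, Nat.factorial_succ, Nat.cast_mul,
    Real.log_mul hN0.ne' hM0.ne', Real.log_mul (by norm_num) hN0.ne',
    Real.log_div hN0.ne' (Real.exp_ne_zero 1), Real.log_div (Real.exp_ne_zero 1) (by positivity),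
    Real.log_exp, Real.log_sqrt (by norm_num)] at hst'
  have hl2 : Real.log 2 ≤ 1 := by linarith [Real.log_le_sub_one_of_pos (x := 2) (by norm_num)]
  have hlpi : Real.log Real.pi ≤ 3 := by
    linarith [Real.log_le_sub_one_of_pos Real.pi_pos, Real.pi_lt_four]
  have hlN : 0 ≤ Real.log ((M + 1 : ℕ) : ℝ) := Real.log_natCast_nonneg _
  nlinarith

lemma half_le_Gamma_half {m : ℕ} (hm : 1 ≤ m) : 1 / 2 ≤ Real.Gamma ((m : ℝ) / 2) := by
  have hpi : 1 ≤ √Real.pi := Real.one_le_sqrt.2 (by linarith [Real.pi_gt_three])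
  rcases Nat.lt_or_ge m 4 with h | h
  · interval_cases m
    · rw [Nat.cast_one, Real.Gamma_one_half_eq]
      linarith
    · norm_num
    · rw [show ((3 : ℕ) : ℝ) / 2 = 1 / 2 + 1 by norm_num, Real.Gamma_add_one (by norm_num),
        Real.Gamma_one_half_eq]
      linarith
  · have h4 : (4 : ℝ) ≤ m := by exact_mod_cast h
    have := Real.Gamma_strictMonoOn_Ici.monotoneOn (Set.mem_Ici.2 le_rfl)
      (Set.mem_Ici.2 (by linarith : (2 : ℝ) ≤ m / 2)) (by linarith)
    rw [Real.Gamma_two] at this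
    linarith

lemma norm_exp_I_mul_taylor_two_le (u : ℝ) :
    ‖Complex.exp (Complex.I * u) - 1 - Complex.I * u + (u : ℂ) ^ 2 / 2‖ ≤ 4 * u ^ 2 ∧
      ‖Complex.exp (Complex.I * u) - 1 - Complex.I * u + (u : ℂ) ^ 2 / 2‖ ≤ 4 * |u| ^ 3 := by
  have hsq : u ^ 2 = |u| ^ 2 := (sq_abs u).symm
  have habs := abs_nonneg u
  rcases le_total |u| 1 with h | h
  · have hb := Complex.exp_bound (x := Complex.I * u) (by simpa using h) (n := 3) (by norm_num)
    have he : ∑ m ∈ Finset.range 3, (Complex.I * (u : ℂ)) ^ m / (m.factorial : ℂ) =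
        1 + Complex.I * u - (u : ℂ) ^ 2 / 2 := by
      simp [Finset.sum_range_succ, mul_pow, Nat.factorial]
      ring
    rw [he, show Complex.exp (Complex.I * u) - (1 + Complex.I * u - (u : ℂ) ^ 2 / 2) =
      Complex.exp (Complex.I * u) - 1 - Complex.I * u + (u : ℂ) ^ 2 / 2 by ring] at hb
    have h3 : ‖Complex.exp (Complex.I * u) - 1 - Complex.I * u + (u : ℂ) ^ 2 / 2‖ ≤ |u| ^ 3 := by
      refine hb.trans ?_
      simp only [norm_mul, Complex.norm_I, Complex.norm_real, Real.norm_eq_abs, one_mul]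
      refine mul_le_of_le_one_right (by positivity) ?_
      norm_num [Nat.factorial]
    have h4 : |u| ^ 3 ≤ |u| ^ 2 := pow_le_pow_of_le_one habs h (by norm_num)
    have h5 : 0 ≤ |u| ^ 3 := by positivity
    rw [hsq]
    constructor <;> linarith [sq_nonneg |u|]
  · have h2 : ‖Complex.exp (Complex.I * u) - 1 - Complex.I * u + (u : ℂ) ^ 2 / 2‖ ≤
        1 + 1 + |u| + |u| ^ 2 / 2 := by
      refine (norm_add_le _ _).trans (add_le_add ((norm_sub_le _ _).trans (add_le_add
        ((norm_sub_le _ _).trans (add_le_add ?_ ?_)) ?_)) ?_)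
      · rw [mul_comm, Complex.norm_exp_ofReal_mul_I]
      · simp
      · simp
      · simp
    have h3 : |u| ≤ |u| ^ 2 := le_self_pow₀ h (by norm_num)
    have h4 : |u| ^ 2 ≤ |u| ^ 3 := pow_le_pow_right₀ h (by norm_num)
    rw [hsq]
    constructor <;> linarith

lemma levyDensity_nonneg {d k : ℕ} (hk : 1 < k) (hkd : k < d) {x : ℝ}
    (hx : x ∈ Set.Ioo (0 : ℝ) 1) : 0 ≤ levyDensity d k x := by
  have hK : (0 : ℝ) < (k : ℝ) - 1 := by
    have : (1 : ℝ) < k := by exact_mod_cast hk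
    linarith
  have hq : (0 : ℝ) < ((d : ℝ) - k) / 2 := by
    have : (k : ℝ) < d := by exact_mod_cast hkd
    linarith
  have hG := Real.Gamma_pos_of_pos hq
  have hx0 := hx.1
  have h1 : x ^ (2 / ((k : ℝ) - 1)) < 1 := Real.rpow_lt_one hx.1.le hx.2 (by positivity)
  have h2 : 0 < 1 - x ^ (2 / ((k : ℝ) - 1)) := by linarith
  have hpi := Real.pi_pos
  unfold levyDensity
  positivity

lemma measurable_levyDensity (d k : ℕ) : Measurable (levyDensity d k) := by
  unfold levyDensity
  fun_prop

lemma sigmaSqHyp_eq {d k : ℕ} (hk : 1 < k) (hkd : k < d) (hdk : d + 1 < 2 * k) :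
    sigmaSqHyp d k = Real.pi ^ (((d : ℝ) - k) / 2) * Real.Gamma ((2 * (k : ℝ) - d - 1) / 2) /
      Real.Gamma (((k : ℝ) - 1) / 2) := by
  have h := (sq_mul_levyDensity_moment hk hkd hdk 0).2
  have hq : (0 : ℝ) < ((d : ℝ) - k) / 2 := by
    have : (k : ℝ) < d := by exact_mod_cast hkd
    linarith
  have hG := (Real.Gamma_pos_of_pos hq).ne'
  simp only [pow_zero, mul_one, Nat.cast_zero, add_zero] at h
  rw [sigmaSqHyp, h, beta,
    show (2 * (k : ℝ) - d - 1) / 2 + ((d : ℝ) - k) / 2 = ((k : ℝ) - 1) / 2 by ring]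
  field_simp

lemma sigmaSqHyp_pos {d k : ℕ} (hk : 1 < k) (hkd : k < d) (hdk : d + 1 < 2 * k) :
    0 < sigmaSqHyp d k := by
  have hK : (0 : ℝ) < (k : ℝ) - 1 := by
    have : (1 : ℝ) < k := by exact_mod_cast hk
    linarith
  have hp : (0 : ℝ) < (2 * (k : ℝ) - d - 1) / 2 := by
    have : (d : ℝ) + 1 < 2 * k := by exact_mod_cast hdk
    linarith
  have h1 := Real.Gamma_pos_of_pos hp
  have h2 := Real.Gamma_pos_of_pos (half_pos hK)
  rw [sigmaSqHyp_eq hk hkd hdk]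
  positivity

/-- Variance bound for the law with density proportional to `x ^ 2 * levyDensity d k x`, in the
variable `x ^ (2 / (k - 1))`. -/
lemma sq_mul_levyDensity_variance {d k : ℕ} (hk : 1 < k) (hkd : k < d) (hdk : d + 1 < 2 * k) :
    IntegrableOn (fun x : ℝ => x ^ 2 * levyDensity d k x *
        (x ^ (2 / ((k : ℝ) - 1)) - (2 * (k : ℝ) - d - 1) / ((k : ℝ) - 1)) ^ 2) (Set.Ioo 0 1) ∧
      ∫ x in Set.Ioo (0 : ℝ) 1, x ^ 2 * levyDensity d k x *
        (x ^ (2 / ((k : ℝ) - 1)) - (2 * (k : ℝ) - d - 1) / ((k : ℝ) - 1)) ^ 2 ≤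
      sigmaSqHyp d k * (2 * (2 * (k : ℝ) - d - 1) / ((k : ℝ) - 1) ^ 2) := by
  have hK : (0 : ℝ) < (k : ℝ) - 1 := by
    have : (1 : ℝ) < k := by exact_mod_cast hk
    linarith
  have hq : (0 : ℝ) < ((d : ℝ) - k) / 2 := by
    have : (k : ℝ) < d := by exact_mod_cast hkd
    linarith
  have hp : (0 : ℝ) < (2 * (k : ℝ) - d - 1) / 2 := by
    have : (d : ℝ) + 1 < 2 * k := by exact_mod_cast hdk
    linarith
  have hσ := sigmaSqHyp_pos hk hkd hdk
  obtain ⟨i0, v0⟩ := sq_mul_levyDensity_moment hk hkd hdk 0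
  obtain ⟨i1, v1⟩ := sq_mul_levyDensity_moment hk hkd hdk 1
  obtain ⟨i2, v2⟩ := sq_mul_levyDensity_moment hk hkd hdk 2
  have hs : sigmaSqHyp d k = ∫ x in Set.Ioo (0 : ℝ) 1,
      x ^ 2 * levyDensity d k x * (x ^ (2 / ((k : ℝ) - 1))) ^ 0 := by
    simp [sigmaSqHyp]
  rw [v0] at hs
  set p := (2 * (k : ℝ) - d - 1) / 2 with hpdef
  set q := ((d : ℝ) - k) / 2 with hqdef
  have hKpq : (k : ℝ) - 1 = 2 * (p + q) := by rw [hpdef, hqdef]; ring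
  have hm : 2 * (k : ℝ) - d - 1 = 2 * p := by rw [hpdef]; ring
  set r := 2 / ((k : ℝ) - 1)
  rw [hm, hKpq]
  set c := Real.pi ^ q / Real.Gamma q
  have hμ : 2 * p / (2 * (p + q)) = p / (p + q) := by field_simp
  rw [hμ]
  set e := p / (p + q) with he
  have heq : (fun x : ℝ => x ^ 2 * levyDensity d k x * (x ^ r - e) ^ 2) = fun x =>
      x ^ 2 * levyDensity d k x * (x ^ r) ^ 2 - 2 * e * (x ^ 2 * levyDensity d k x * (x ^ r) ^ 1)
        + e ^ 2 * (x ^ 2 * levyDensity d k x * (x ^ r) ^ 0) := by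
    funext x
    ring
  rw [heq]
  have i12 : IntegrableOn (fun x : ℝ => x ^ 2 * levyDensity d k x * (x ^ r) ^ 2 -
      2 * e * (x ^ 2 * levyDensity d k x * (x ^ r) ^ 1)) (Set.Ioo 0 1) :=
    i2.sub (i1.const_mul (2 * e))
  refine ⟨i12.add (i0.const_mul (e ^ 2)), ?_⟩
  rw [integral_add i12 (i0.const_mul (e ^ 2)), integral_sub i2 (i1.const_mul (2 * e)),
    integral_const_mul, integral_const_mul, v0, v1, v2]
  have b1 : beta (p + (1 : ℕ)) q = p / (p + q) * beta p q := by
    rw [Nat.cast_one, beta_add_one hp hq]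
  have b2 : beta (p + (2 : ℕ)) q = (p + 1) / (p + 1 + q) * (p / (p + q) * beta p q) := by
    rw [show p + ((2 : ℕ) : ℝ) = p + 1 + 1 by push_cast; ring,
      beta_add_one (by positivity) hq, beta_add_one hp hq]
  rw [b1, b2]
  simp only [Nat.cast_zero, add_zero] at hs ⊢
  have hpq : 0 < p + q := by positivity
  have hpq1 : 0 < p + 1 + q := by positivity
  have hvar : c * ((p + 1) / (p + 1 + q) * (p / (p + q) * beta p q)) -
      2 * e * (c * (p / (p + q) * beta p q)) + e ^ 2 * (c * beta p q) =
      sigmaSqHyp d k * (p / (p + q) ^ 2 * (q / (p + 1 + q))) := by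
    rw [hs, he]
    field_simp
    ring
  rw [hvar]
  have h1 : q / (p + 1 + q) ≤ 1 := (div_le_one hpq1).2 (by linarith)
  have h2 : 2 * (2 * p) / (2 * (p + q)) ^ 2 = p / (p + q) ^ 2 * 1 := by
    field_simp
  rw [h2]
  gcongr

lemma norm_levyExponent_add_le {d k : ℕ} (hk : 1 < k) (hkd : k < d) (hdk : d + 1 < 2 * k)
    (t : ℝ) {ε δ : ℝ} (hε : 0 < ε) (hδ : 0 < δ)
    (hgap : (2 * (k : ℝ) - d - 1) / ((k : ℝ) - 1) + δ ≤
      (ε * sigmaHyp d k) ^ (2 / ((k : ℝ) - 1))) :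
    ‖(∫ x in Set.Ioo (0 : ℝ) 1,
        (Complex.exp (Complex.I * t * (x / sigmaHyp d k)) - 1 -
            Complex.I * t * (x / sigmaHyp d k)) * (levyDensity d k x : ℂ)) + (t : ℂ) ^ 2 / 2‖ ≤
      4 * |t| ^ 3 * ε + 4 * t ^ 2 * (2 * (2 * (k : ℝ) - d - 1) / ((k : ℝ) - 1) ^ 2) / δ ^ 2 := by
  have hK : (0 : ℝ) < (k : ℝ) - 1 := by
    have : (1 : ℝ) < k := by exact_mod_cast hk
    linarith
  have hσ2 := sigmaSqHyp_pos hk hkd hdk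
  have hσ : 0 < sigmaHyp d k := Real.sqrt_pos.2 hσ2
  have hσsq : sigmaHyp d k ^ 2 = sigmaSqHyp d k := Real.sq_sqrt hσ2.le
  obtain ⟨iv, hv⟩ := sq_mul_levyDensity_variance hk hkd hdk
  have i0 : IntegrableOn (fun x : ℝ => x ^ 2 * levyDensity d k x) (Set.Ioo 0 1) := by
    simpa using (sq_mul_levyDensity_moment hk hkd hdk 0).1
  set σ := sigmaHyp d k
  set r := 2 / ((k : ℝ) - 1) with hr
  have hr0 : 0 < r := by positivity
  set e := (2 * (k : ℝ) - d - 1) / ((k : ℝ) - 1)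
  set f := levyDensity d k
  set F : ℝ → ℂ := fun x => (Complex.exp (Complex.I * t * (x / σ)) - 1 -
            Complex.I * t * (x / σ)) * (f x : ℂ) with hF
  set Q : ℝ → ℂ := fun x => (((t ^ 2 / (2 * σ ^ 2)) * (x ^ 2 * f x) : ℝ) : ℂ) with hQ
  set G : ℝ → ℝ := fun x => 4 * |t| ^ 3 * ε / σ ^ 2 * (x ^ 2 * f x) +
    4 * t ^ 2 / (σ ^ 2 * δ ^ 2) * (x ^ 2 * f x * (x ^ r - e) ^ 2) with hG
  have iQ : IntegrableOn Q (Set.Ioo 0 1) := (i0.const_mul _).ofReal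
  have iG : IntegrableOn G (Set.Ioo 0 1) := (i0.const_mul _).add (iv.const_mul _)
  have hfm : Measurable f := measurable_levyDensity d k
  have hbound : ∀ x ∈ Set.Ioo (0 : ℝ) 1, ‖F x + Q x‖ ≤ G x := by
    intro x hx
    have hx0 := hx.1
    have hfx : 0 ≤ f x := levyDensity_nonneg hk hkd hx
    obtain ⟨hb2, hb3⟩ := norm_exp_I_mul_taylor_two_le (t * x / σ)
    have hFQ : F x + Q x = (Complex.exp (Complex.I * (t * x / σ : ℝ)) - 1 -
        Complex.I * (t * x / σ : ℝ) + ((t * x / σ : ℝ) : ℂ) ^ 2 / 2) * (f x : ℂ) := by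
      simp only [hF, hQ]
      have hσc : (σ : ℂ) ≠ 0 := by exact_mod_cast hσ.ne'
      rw [show Complex.I * t * ((x : ℂ) / σ) = Complex.I * (t * x / σ : ℝ) by push_cast; ring]
      push_cast
      field_simp
    rw [hFQ, norm_mul, Complex.norm_real, Real.norm_of_nonneg hfx]
    have hterm1 : 0 ≤ 4 * |t| ^ 3 * ε / σ ^ 2 * (x ^ 2 * f x) := by positivity
    have hterm2 : 0 ≤ 4 * t ^ 2 / (σ ^ 2 * δ ^ 2) * (x ^ 2 * f x * (x ^ r - e) ^ 2) := by
      positivity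
    rcases le_total x (ε * σ) with hxε | hxε
    · have h1 : 4 * |t * x / σ| ^ 3 * f x ≤ 4 * |t| ^ 3 * ε / σ ^ 2 * (x ^ 2 * f x) := by
        rw [abs_div, abs_mul, abs_of_pos hx0, abs_of_pos hσ]
        have h2 : x / σ ≤ ε := (div_le_iff₀ hσ).2 hxε
        calc 4 * (|t| * x / σ) ^ 3 * f x = 4 * |t| ^ 3 * (x / σ) / σ ^ 2 * (x ^ 2 * f x) := by
              field_simp
          _ ≤ _ := by gcongr
      have h2 := mul_le_mul_of_nonneg_right hb3 hfx
      simp only [hG]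
      linarith
    · have hxr : δ ≤ x ^ r - e := by
        have := Real.rpow_le_rpow (by positivity) hxε hr0.le
        linarith
      have h1 : 4 * (t * x / σ) ^ 2 * f x ≤
          4 * t ^ 2 / (σ ^ 2 * δ ^ 2) * (x ^ 2 * f x * (x ^ r - e) ^ 2) := by
        calc 4 * (t * x / σ) ^ 2 * f x
            = 4 * t ^ 2 / (σ ^ 2 * δ ^ 2) * (x ^ 2 * f x * δ ^ 2) := by field_simp
          _ ≤ _ := by gcongr
      have h2 := mul_le_mul_of_nonneg_right hb2 hfx
      simp only [hG]
      linarith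
  have hFm : Measurable F := by
    simp only [hF]
    fun_prop
  have iFQ : IntegrableOn (fun x => F x + Q x) (Set.Ioo 0 1) := by
    refine Integrable.mono' iG (hFm.aestronglyMeasurable.add iQ.aestronglyMeasurable) ?_
    filter_upwards [ae_restrict_mem measurableSet_Ioo] with x hx using hbound x hx
  have iF : IntegrableOn F (Set.Ioo 0 1) := by
    refine (iFQ.sub iQ).congr (Eventually.of_forall fun x => ?_)
    simp
  have hQv : ∫ x in Set.Ioo (0 : ℝ) 1, Q x = (t : ℂ) ^ 2 / 2 := by
    simp only [hQ]
    rw [integral_complex_ofReal, integral_const_mul]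
    have : ∫ x in Set.Ioo (0 : ℝ) 1, x ^ 2 * f x = σ ^ 2 := by rw [hσsq]; rfl
    rw [this, show t ^ 2 / (2 * σ ^ 2) * σ ^ 2 = t ^ 2 / 2 by field_simp]
    push_cast
    rfl
  rw [← hQv, ← integral_add iF iQ]
  calc ‖∫ x in Set.Ioo (0 : ℝ) 1, (F x + Q x)‖ ≤ ∫ x in Set.Ioo (0 : ℝ) 1, G x := by
        refine norm_integral_le_of_norm_le iG ?_
        filter_upwards [ae_restrict_mem measurableSet_Ioo] with x hx using hbound x hx
    _ = 4 * |t| ^ 3 * ε / σ ^ 2 * σ ^ 2 + 4 * t ^ 2 / (σ ^ 2 * δ ^ 2) *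
        ∫ x in Set.Ioo (0 : ℝ) 1, x ^ 2 * f x * (x ^ r - e) ^ 2 := by
        simp only [hG]
        rw [integral_add (i0.const_mul _) (iv.const_mul _), integral_const_mul, integral_const_mul,
          hσsq]
        rfl
    _ ≤ 4 * |t| ^ 3 * ε / σ ^ 2 * σ ^ 2 + 4 * t ^ 2 / (σ ^ 2 * δ ^ 2) *
        (sigmaSqHyp d k * (2 * (2 * (k : ℝ) - d - 1) / ((k : ℝ) - 1) ^ 2)) := by gcongr
    _ = _ := by
        rw [← hσsq]
        field_simp

lemma exp_div_sqrt_le_rpow_sigmaHyp {d k : ℕ} (hk : 5 ≤ k) (hkd : k < d) (hdk : d + 1 < 2 * k)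
    {ε : ℝ} (hε : 0 < ε) :
    Real.exp ((2 * Real.log ε - 3) / ((k : ℝ) - 1) +
        ((d : ℝ) - k) / 2 / ((k : ℝ) - 1) * Real.log Real.pi + (1 + Real.log 2) / 2) /
        √((k : ℝ) - 1) ≤ (ε * sigmaHyp d k) ^ (2 / ((k : ℝ) - 1)) := by
  obtain ⟨N, rfl⟩ : ∃ N, k = N + 1 := ⟨k - 1, by omega⟩
  obtain ⟨m, hm⟩ : ∃ m : ℕ, 2 * (N + 1) = d + 1 + m := ⟨2 * (N + 1) - (d + 1), by omega⟩
  have hm1 : 1 ≤ m := by omega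
  have hmR : 2 * ((N + 1 : ℕ) : ℝ) - d - 1 = m := by
    have : (2 * ((N + 1 : ℕ) : ℝ)) = d + 1 + m := by exact_mod_cast hm
    linarith
  have hσ2 := sigmaSqHyp_pos (by omega) hkd hdk
  have hσ : 0 < sigmaHyp d (N + 1) := Real.sqrt_pos.2 hσ2
  have hKN : ((N + 1 : ℕ) : ℝ) - 1 = N := by push_cast; ring
  have hN : (0 : ℝ) < N := by
    have : 0 < N := by omega
    exact_mod_cast this
  have h1 := half_le_Gamma_half hm1
  have h2 := log_Gamma_half_le (N := N) (by omega)
  have h3 : -Real.log 2 ≤ Real.log (Real.Gamma ((m : ℝ) / 2)) := by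
    have := Real.log_le_log (by norm_num) h1
    rwa [one_div, Real.log_inv] at this
  have hl2 : Real.log 2 ≤ 1 := by linarith [Real.log_le_sub_one_of_pos (x := 2) (by norm_num)]
  have hG : 0 < Real.Gamma ((m : ℝ) / 2) := by linarith
  have hG' : 0 < Real.Gamma ((N : ℝ) / 2) := Real.Gamma_pos_of_pos (by positivity)
  have hlogσ : Real.log (sigmaHyp d (N + 1)) = 1 / 2 * ((((d : ℝ) - (N + 1 : ℕ)) / 2) *
      Real.log Real.pi + Real.log (Real.Gamma ((m : ℝ) / 2)) -
        Real.log (Real.Gamma ((N : ℝ) / 2))) := by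
    rw [sigmaHyp, Real.log_sqrt hσ2.le, sigmaSqHyp_eq (by omega) hkd hdk, hmR, hKN,
      Real.log_div (by positivity) hG'.ne', Real.log_mul (by positivity) hG.ne',
      Real.log_rpow Real.pi_pos]
    ring
  rw [hKN, ← Real.exp_log (Real.sqrt_pos.2 hN), ← Real.exp_sub,
    Real.rpow_def_of_pos (by positivity), Real.exp_le_exp, Real.log_sqrt hN.le,
    Real.log_mul hε.ne' hσ.ne', hlogσ]
  have h4 : (Real.log ε + 1 / 2 * ((((d : ℝ) - (N + 1 : ℕ)) / 2) *
      Real.log Real.pi - 1 - ((N : ℝ) / 2 * (Real.log N - 1 - Real.log 2) + 2))) * (2 / N) ≤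
      (Real.log ε + 1 / 2 * ((((d : ℝ) - (N + 1 : ℕ)) / 2) *
      Real.log Real.pi + Real.log (Real.Gamma ((m : ℝ) / 2)) -
        Real.log (Real.Gamma ((N : ℝ) / 2)))) * (2 / N) := by
    gcongr
    linarith
  refine le_trans (le_of_eq ?_) h4
  field_simp
  ring

lemma eventually_sq_div_le {d k : ℕ → ℕ}
    (hadm : ∀ n, 1 ≤ k n ∧ k n + 1 ≤ d n ∧ d n + 1 < 2 * k n)
    (hd : Tendsto d atTop atTop)
    (hratio : Tendsto (fun n => (d n : ℝ) / (k n : ℝ)) atTop (nhds 2))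
    (hratio' : Tendsto (fun n => (d n : ℝ) / ((k n : ℝ) - 1)) atTop (nhds 2))
    {c c' : ℝ} (hc : 0 < c) (hcc : 2 * c < c')
    (hev : ∀ᶠ n in atTop, ((d n : ℝ))⁻¹ *
          (2 * (k n : ℝ) - (d n : ℝ) - 1) ^ ((d n : ℝ) / (k n : ℝ)) < c) :
    ∀ᶠ n in atTop, (2 * (k n : ℝ) - (d n : ℝ) - 1) ^ 2 / ((k n : ℝ) - 1) ≤ c' := by
  have hD : Tendsto (fun n => c * (d n : ℝ)) atTop atTop :=
    (tendsto_natCast_atTop_atTop.comp hd).const_mul_atTop hc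
  have hlog : Tendsto (fun y : ℝ => Real.log y / y ^ (1 / 3 : ℝ)) atTop (nhds 0) :=
    (isLittleO_log_rpow_atTop (by norm_num)).tendsto_div_nhds_zero
  have hE : Tendsto (fun n => 4 / 3 * c * ((d n : ℝ) / (k n : ℝ)) *
      (Real.log (c * d n) / (c * d n) ^ (1 / 3 : ℝ))) atTop (nhds 0) := by
    have := (hratio.const_mul (4 / 3 * c)).mul (hlog.comp hD)
    simpa using this
  have hB : Tendsto (fun n => c * ((d n : ℝ) / ((k n : ℝ) - 1)) *
      Real.exp (4 / 3 * c * ((d n : ℝ) / (k n : ℝ)) *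
      (Real.log (c * d n) / (c * d n) ^ (1 / 3 : ℝ)))) atTop (nhds (2 * c)) := by
    have := (hratio'.const_mul c).mul ((Real.continuous_exp.tendsto 0).comp hE)
    rw [Real.exp_zero, mul_one, mul_comm c 2] at this
    exact this
  filter_upwards [hev, hB.eventually_lt_const hcc,
    hratio.eventually_const_lt (show (3 / 2 : ℝ) < 2 by norm_num)] with n h1 h2 h3
  obtain ⟨ha, hb, hc3⟩ := hadm n
  refine le_trans ?_ h2.le
  have hk1 : (1 : ℝ) < k n := by
    have : 1 < k n := by omega
    exact_mod_cast this
  have hk0 : (0 : ℝ) < k n := by linarith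
  have hd0 : (0 : ℝ) < d n := by
    have : 0 < d n := by omega
    exact_mod_cast this
  set m : ℝ := 2 * (k n : ℝ) - (d n : ℝ) - 1 with hm
  have hm1 : 1 ≤ m := by
    have : (d n : ℝ) + 1 + 1 ≤ 2 * k n := by exact_mod_cast hc3
    linarith
  have hm0 : 0 < m := by linarith
  set y := c * (d n : ℝ) with hy
  have hy0 : 0 < y := by positivity
  have hl0 : 0 ≤ Real.log m := Real.log_nonneg hm1
  have h4 : (d n : ℝ) / (k n : ℝ) * Real.log m ≤ Real.log y := by
    have h5 : m ^ ((d n : ℝ) / (k n : ℝ)) ≤ y := by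
      rw [inv_mul_lt_iff₀ hd0] at h1
      linarith
    have := Real.log_le_log (by positivity) h5
    rwa [Real.log_rpow hm0] at this
  have h5 : Real.log m ≤ 2 / 3 * Real.log y := by nlinarith
  have h6 : m ≤ y ^ (2 / 3 : ℝ) := by
    rw [← Real.log_le_log_iff hm0 (by positivity), Real.log_rpow hy0]
    exact h5
  have h7 : 2 * Real.log m ≤ Real.log y + 2 * m / k n * Real.log m := by
    have : 2 * Real.log m = (d n : ℝ) / k n * Real.log m + (m + 1) / k n * Real.log m := by
      rw [hm]
      field_simp
      ring
    rw [this]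
    have h8 : (m + 1) / k n * Real.log m ≤ 2 * m / k n * Real.log m := by
      gcongr
      linarith
    linarith
  have h8 : 2 * m / k n * Real.log m ≤ 4 / 3 * c * ((d n : ℝ) / (k n : ℝ)) *
      (Real.log y / y ^ (1 / 3 : ℝ)) := by
    calc 2 * m / k n * Real.log m ≤ 2 * y ^ (2 / 3 : ℝ) / k n * (2 / 3 * Real.log y) := by
          gcongr
      _ = _ := by
          have h9 : y ^ (2 / 3 : ℝ) * y ^ (1 / 3 : ℝ) = y := by
            rw [← Real.rpow_add hy0]
            norm_num
          have h10 : 0 < y ^ (1 / 3 : ℝ) := by positivity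
          rw [show y ^ (2 / 3 : ℝ) = y / y ^ (1 / 3 : ℝ) by rw [eq_div_iff h10.ne', h9], hy]
          field_simp
          ring
  have h9 : m ^ 2 ≤ y * Real.exp (4 / 3 * c * ((d n : ℝ) / (k n : ℝ)) *
      (Real.log y / y ^ (1 / 3 : ℝ))) := by
    rw [← Real.log_le_log_iff (by positivity) (by positivity), Real.log_pow,
      Real.log_mul hy0.ne' (Real.exp_ne_zero _), Real.log_exp]
    push_cast
    linarith
  have hK : (0 : ℝ) < (k n : ℝ) - 1 := by linarith
  rw [div_le_iff₀ hK]
  refine h9.trans (le_of_eq ?_)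
  rw [hy]
  field_simp

/-- High-dimensional CLT for the variance-normalized hyperbolic limit variables: if
`(d_n,k_n)` is admissible (`1 ≤ k_n ≤ d_n−1`, `2k_n > d_n+1`), `d_n → ∞`, `k_n/d_n → 1/2`
and `limsup d_n⁻¹ (2k_n−d_n−1)^{d_n/k_n} < eπ`, then the probability measures `μ n` with
characteristic function
`exp(∫_0^1 (e^{itx/σ_{d_n,k_n}} − 1 − itx/σ_{d_n,k_n}) f_{d_n,k_n}(x) dx)`
converge weakly to the standard Gaussian measure `N(0,1)`. -/
theorem hyperbolic_CLT (d k : ℕ → ℕ)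
    (hadm : ∀ n, 1 ≤ k n ∧ k n + 1 ≤ d n ∧ d n + 1 < 2 * k n)
    (hd : Tendsto d atTop atTop)
    (hratio : Tendsto (fun n => (k n : ℝ) / (d n : ℝ)) atTop (nhds (1 / 2)))
    (hsup : Filter.limsup
        (fun n => (((d n : ℝ))⁻¹ *
          (2 * (k n : ℝ) - (d n : ℝ) - 1) ^ ((d n : ℝ) / (k n : ℝ)) : ℝ) : ℕ → EReal)
        atTop < ((Real.exp 1 * Real.pi : ℝ) : EReal))
    (μ : ℕ → ProbabilityMeasure ℝ)
    (hchar : ∀ n, ∀ t : ℝ, charFn (μ n) t =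
      Complex.exp (∫ x in Set.Ioo (0 : ℝ) 1,
        (Complex.exp (Complex.I * t * (x / sigmaHyp (d n) (k n))) - 1 -
            Complex.I * t * (x / sigmaHyp (d n) (k n))) *
          (levyDensity (d n) (k n) x : ℂ))) :
    Tendsto μ atTop (nhds ⟨gaussianReal 0 1, inferInstance⟩) := by
  have hdR : Tendsto (fun n => (d n : ℝ)) atTop atTop := tendsto_natCast_atTop_atTop.comp hd
  have hkd0 : ∀ n, (0 : ℝ) < d n := fun n => by
    have := hadm n
    exact_mod_cast (by omega : 0 < d n)
  have hk3 : ∀ n, 1 < k n := fun n => by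
    have := hadm n
    omega
  have hk1 : ∀ n, (0 : ℝ) < (k n : ℝ) - 1 := fun n => by
    have : (1 : ℝ) < k n := by exact_mod_cast hk3 n
    linarith
  have hkR : Tendsto (fun n => (k n : ℝ)) atTop atTop := by
    have := hdR.atTop_mul_pos (show (0 : ℝ) < 1 / 2 by norm_num) hratio
    refine this.congr fun n => ?_
    have := (hkd0 n).ne'
    field_simp
  have hKR : Tendsto (fun n => (k n : ℝ) - 1) atTop atTop :=
    tendsto_atTop_add_const_right _ _ hkR
  have hratio1 : Tendsto (fun n => (d n : ℝ) / (k n : ℝ)) atTop (nhds 2) := by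
    have := hratio.inv₀ (by norm_num)
    norm_num at this
    exact this
  have hratio3 : Tendsto (fun n => ((k n : ℝ) - 1) / (d n : ℝ)) atTop (nhds (1 / 2)) := by
    have := hratio.sub (tendsto_inv_atTop_zero.comp hdR)
    rw [sub_zero] at this
    refine this.congr fun n => ?_
    simp only [Function.comp_apply]
    ring
  have hratio2 : Tendsto (fun n => (d n : ℝ) / ((k n : ℝ) - 1)) atTop (nhds 2) := by
    have := hratio3.inv₀ (by norm_num)
    norm_num at this
    exact this
  obtain ⟨c, hc1, hc2⟩ := EReal.lt_iff_exists_real_btwn.1 hsup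
  have hev : ∀ᶠ n in atTop, ((d n : ℝ))⁻¹ *
      (2 * (k n : ℝ) - (d n : ℝ) - 1) ^ ((d n : ℝ) / (k n : ℝ)) < c := by
    filter_upwards [eventually_lt_of_limsup_lt hc1] with n hn
    exact EReal.coe_lt_coe_iff.1 hn
  have hc2' : c < Real.exp 1 * Real.pi := EReal.coe_lt_coe_iff.1 hc2
  have hm0 : ∀ n, (0 : ℝ) < 2 * (k n : ℝ) - d n - 1 := fun n => by
    have : (d n : ℝ) + 1 < 2 * k n := by exact_mod_cast (hadm n).2.2
    linarith
  have hc0 : 0 < c := by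
    obtain ⟨n, hn⟩ := hev.exists
    have := hkd0 n
    have := hm0 n
    exact lt_trans (by positivity) hn
  have hm2 := eventually_sq_div_le hadm hd hratio1 hratio2 hc0
    (show 2 * c < c + Real.exp 1 * Real.pi by linarith) hev
  set c' := c + Real.exp 1 * Real.pi
  set L := Real.exp (1 / 2 * Real.log Real.pi + (1 + Real.log 2) / 2) with hL
  have hcL : √c' < L := by
    have hL2 : L ^ 2 = 2 * (Real.exp 1 * Real.pi) := by
      rw [hL, ← Real.exp_nat_mul, show ((2 : ℕ) : ℝ) * (1 / 2 * Real.log Real.pi +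
        (1 + Real.log 2) / 2) = Real.log 2 + (1 + Real.log Real.pi) by push_cast; ring,
        Real.exp_add, Real.exp_add, Real.exp_log (by norm_num), Real.exp_log Real.pi_pos]
    rw [Real.sqrt_lt' (Real.exp_pos _), hL2]
    linarith
  obtain ⟨η, hη, hηL⟩ : ∃ η, 0 < η ∧ √c' + η < L :=
    ⟨(L - √c') / 2, by linarith, by linarith⟩
  refine ProbabilityMeasure.tendsto_iff_tendsto_charFun.2 fun t => ?_
  have hcf : ∀ n, MeasureTheory.charFun (μ n : Measure ℝ) t = charFn (μ n) t := fun n => by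
    rw [charFun_apply_real, charFn]
    congr 1 with x
    congr 1
    ring
  have hlim : MeasureTheory.charFun (gaussianReal 0 1) t = Complex.exp (-((t : ℂ) ^ 2 / 2)) := by
    rw [charFun_gaussianReal]
    simp
  change Tendsto _ _ (nhds (MeasureTheory.charFun (gaussianReal 0 1) t))
  rw [hlim]
  simp_rw [hcf, hchar]
  refine (Complex.continuous_exp.tendsto _).comp ?_
  rw [Metric.tendsto_nhds]
  intro e he
  obtain ⟨ε, hε, hεe⟩ : ∃ ε, 0 < ε ∧ 4 * |t| ^ 3 * ε < e / 2 := by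
    refine ⟨e / 2 / (4 * |t| ^ 3 + 1), by positivity, ?_⟩
    rw [mul_div_assoc', div_lt_iff₀ (by positivity)]
    nlinarith
  have hq : Tendsto (fun n => ((d n : ℝ) - k n) / 2 / ((k n : ℝ) - 1)) atTop (nhds (1 / 2)) := by
    have h1 := ((hratio2.sub_const 1).sub (tendsto_inv_atTop_zero.comp hKR)).div_const 2
    rw [show ((2 : ℝ) - 1 - 0) / 2 = 1 / 2 by norm_num] at h1
    refine h1.congr fun n => ?_
    have := (hk1 n).ne'
    simp only [Function.comp_apply]
    field_simp
    ring
  have hA : Tendsto (fun n => Real.exp ((2 * Real.log ε - 3) / ((k n : ℝ) - 1) +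
        ((d n : ℝ) - k n) / 2 / ((k n : ℝ) - 1) * Real.log Real.pi + (1 + Real.log 2) / 2))
      atTop (nhds L) := by
    refine (Real.continuous_exp.tendsto _).comp ?_
    have := ((hKR.const_div_atTop (2 * Real.log ε - 3)).add
      (hq.mul_const (Real.log Real.pi))).add_const ((1 + Real.log 2) / 2)
    rwa [zero_add] at this
  have hrest : Tendsto (fun n => 8 * t ^ 2 / η ^ 2 * (√c' / √((k n : ℝ) - 1))) atTop (nhds 0) := by
    have := ((Real.tendsto_sqrt_atTop.comp hKR).const_div_atTop (√c')).const_mul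
      (8 * t ^ 2 / η ^ 2)
    rwa [mul_zero] at this
  filter_upwards [hm2, hA.eventually_const_lt hηL, hrest.eventually_lt_const (half_pos he),
    hkR.eventually_ge_atTop 5] with n h1 h2 h3 h4
  obtain ⟨-, hb, hdk⟩ := hadm n
  have hk5 : 5 ≤ k n := by exact_mod_cast h4
  have hK := hk1 n
  have hsK : 0 < √((k n : ℝ) - 1) := Real.sqrt_pos.2 hK
  have hsK2 : √((k n : ℝ) - 1) ^ 2 = (k n : ℝ) - 1 := Real.sq_sqrt hK.le
  have hmK : (2 * (k n : ℝ) - d n - 1) / ((k n : ℝ) - 1) ≤ √c' / √((k n : ℝ) - 1) := by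
    have h5 : (2 * (k n : ℝ) - d n - 1) / √((k n : ℝ) - 1) ≤ √c' := by
      refine Real.le_sqrt_of_sq_le ?_
      rwa [div_pow, hsK2]
    calc (2 * (k n : ℝ) - d n - 1) / ((k n : ℝ) - 1)
        = (2 * (k n : ℝ) - d n - 1) / √((k n : ℝ) - 1) / √((k n : ℝ) - 1) := by
          rw [div_div, ← sq, hsK2]
      _ ≤ _ := by gcongr
  have hgap : (2 * (k n : ℝ) - d n - 1) / ((k n : ℝ) - 1) + η / √((k n : ℝ) - 1) ≤
      (ε * sigmaHyp (d n) (k n)) ^ (2 / ((k n : ℝ) - 1)) := by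
    refine le_trans ?_ (exp_div_sqrt_le_rpow_sigmaHyp hk5 (by omega) hdk hε)
    refine le_trans (add_le_add_left hmK _) ?_
    rw [← add_div]
    gcongr
  have hfin := norm_levyExponent_add_le (hk3 n) (by omega) hdk t hε
    (div_pos hη hsK) hgap
  rw [dist_eq_norm, sub_neg_eq_add]
  refine hfin.trans_lt ?_
  have h6 : 4 * t ^ 2 * (2 * (2 * (k n : ℝ) - d n - 1) / ((k n : ℝ) - 1) ^ 2) /
      (η / √((k n : ℝ) - 1)) ^ 2 =
      8 * t ^ 2 / η ^ 2 * ((2 * (k n : ℝ) - d n - 1) / ((k n : ℝ) - 1)) := by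
    rw [div_pow, hsK2]
    field_simp
    ring
  have h7 : 8 * t ^ 2 / η ^ 2 * ((2 * (k n : ℝ) - d n - 1) / ((k n : ℝ) - 1)) ≤
      8 * t ^ 2 / η ^ 2 * (√c' / √((k n : ℝ) - 1)) := by gcongr
  rw [h6]
  linarith
end

section
/- Fix b ∈ ℕ with b ≥ 1, and let (d_n, k_n) be a sequence of admissible dimension pairs with d_n − k_n = b for all n and d_n → ∞. For each n let μ_n be a probability measure on ℝ whose characteristic function is φ_n(t) = exp( σ_{d_n,k_n}^{-2} ∫_0^1 ( e^{itx} − 1 − itx ) f_{d_n,k_n}(x) dx ) for all t ∈ ℝ, and let μ^{(b)} be a probability measure on ℝ with characteristic function φ^{(b)}(t) = exp( Γ(b/2)^{-1} ∫_0^1 ( e^{itx} − 1 − itx ) x^{−2} (−log x)^{(b−2)/2} dx ). Then μ_n converges weakly to μ^{(b)} as n → ∞. -/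
open MeasureTheory ProbabilityTheory Filter

/-- The image of `(0, ∞)` under `y ↦ exp (-y)` is `(0, 1)`. -/
lemma image_exp_neg_Ioi : (fun y : ℝ => Real.exp (-y)) '' Set.Ioi 0 = Set.Ioo 0 1 := by
  ext x
  constructor
  · rintro ⟨y, hy, rfl⟩
    exact ⟨Real.exp_pos _, Real.exp_lt_one_iff.mpr (neg_lt_zero.mpr hy)⟩
  · rintro ⟨h0, h1⟩
    exact ⟨-Real.log x, neg_pos.mpr (Real.log_neg h0 h1), by simp [Real.exp_log h0]⟩

lemma hasDerivWithinAt_exp_neg (s : Set ℝ) (y : ℝ) :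
    HasDerivWithinAt (fun y : ℝ => Real.exp (-y)) (-Real.exp (-y)) s y := by
  simpa using ((hasDerivAt_neg y).exp).hasDerivWithinAt

lemma injOn_exp_neg (s : Set ℝ) : Set.InjOn (fun y : ℝ => Real.exp (-y)) s :=
  fun _ _ _ _ h => neg_injective (Real.exp_injective h)

lemma integrableOn_rpow_mul_neg_log_rpow {a s : ℝ} (ha : -1 < a) (hs : -1 < s) :
    IntegrableOn (fun x : ℝ => x ^ a * (-Real.log x) ^ s) (Set.Ioo 0 1) := by
  rw [← image_exp_neg_Ioi, integrableOn_image_iff_integrableOn_abs_deriv_smul measurableSet_Ioi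
    (fun y _ => hasDerivWithinAt_exp_neg _ y) (injOn_exp_neg _)]
  refine (integrableOn_rpow_mul_exp_neg_mul_rpow hs one_pos (b := a + 1) (by linarith)).congr_fun
    (fun y _ => ?_) measurableSet_Ioi
  simp only [Real.rpow_one, abs_neg, Real.abs_exp, Real.log_exp, neg_neg, smul_eq_mul,
    ← Real.exp_mul]
  rw [← mul_assoc, ← Real.exp_add, mul_comm]
  ring_nf

lemma integral_neg_log_rpow {s : ℝ} (hs : -1 < s) :
    ∫ x in Set.Ioo (0 : ℝ) 1, (-Real.log x) ^ s = Real.Gamma (s + 1) := by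
  rw [← image_exp_neg_Ioi, integral_image_eq_integral_abs_deriv_smul measurableSet_Ioi
    (fun y _ => hasDerivWithinAt_exp_neg _ y) (injOn_exp_neg _),
    Real.Gamma_eq_integral (by linarith)]
  simp

/-- An approximation of `(-log x) ^ s` on `(0, 1)` as `p → 0+`. -/
noncomputable def logApprox (c s p x : ℝ) : ℝ :=
  x ^ (-(c * p)) * (p⁻¹ * (1 - x ^ p)) ^ s

lemma measurable_logApprox (c s p : ℝ) : Measurable (logApprox c s p) := by
  unfold logApprox
  fun_prop

lemma inv_mul_one_sub_rpow_le {p x : ℝ} (hp : 0 < p) (hx : 0 < x) :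
    p⁻¹ * (1 - x ^ p) ≤ -Real.log x := by
  have h := Real.log_le_sub_one_of_pos (Real.rpow_pos_of_pos hx p)
  rw [Real.log_rpow hx] at h
  rw [inv_mul_le_iff₀ hp]
  linarith

lemma neg_log_mul_rpow_le {p x : ℝ} (hp : 0 < p) (hx : 0 < x) :
    -Real.log x * x ^ p ≤ p⁻¹ * (1 - x ^ p) := by
  have hxp := Real.rpow_pos_of_pos hx p
  have h := Real.one_sub_inv_le_log_of_pos hxp
  rw [Real.log_rpow hx] at h
  rw [le_inv_mul_iff₀ hp]
  have := mul_le_mul_of_nonneg_right h hxp.le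
  rw [sub_mul, inv_mul_cancel₀ hxp.ne'] at this
  linarith

lemma logApprox_nonneg {c s p x : ℝ} (hp : 0 < p) (hx : x ∈ Set.Ioo (0 : ℝ) 1) :
    0 ≤ logApprox c s p x := by
  have h1 := Real.rpow_le_one hx.1.le hx.2.le hp.le
  have h2 : 0 ≤ p⁻¹ * (1 - x ^ p) := mul_nonneg (inv_nonneg.mpr hp.le) (by linarith)
  exact mul_nonneg (Real.rpow_nonneg hx.1.le _) (Real.rpow_nonneg h2 _)

lemma logApprox_le {c s p x : ℝ} (hp : 0 < p) (hcp : (c + |s|) * p ≤ 1 / 2)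
    (hx : x ∈ Set.Ioo (0 : ℝ) 1) :
    logApprox c s p x ≤ x ^ (-(1 / 2) : ℝ) * (-Real.log x) ^ s := by
  have hL : 0 < -Real.log x := neg_pos.mpr (Real.log_neg hx.1 hx.2)
  have hxp := Real.rpow_pos_of_pos hx.1 p
  have key : (p⁻¹ * (1 - x ^ p)) ^ s ≤ x ^ (-(|s| * p)) * (-Real.log x) ^ s := by
    rcases le_total 0 s with h | h
    · have h0 : 0 ≤ p⁻¹ * (1 - x ^ p) :=
        (mul_pos hL hxp).le.trans (neg_log_mul_rpow_le hp hx.1)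
      refine (Real.rpow_le_rpow h0 (inv_mul_one_sub_rpow_le hp hx.1) h).trans ?_
      refine le_mul_of_one_le_left (Real.rpow_nonneg hL.le _) ?_
      exact Real.one_le_rpow_of_pos_of_le_one_of_nonpos hx.1 hx.2.le
        (neg_nonpos.mpr (mul_nonneg (abs_nonneg s) hp.le))
    · refine (Real.rpow_le_rpow_of_nonpos (mul_pos hL hxp)
        (neg_log_mul_rpow_le hp hx.1) h).trans (le_of_eq ?_)
      rw [Real.mul_rpow hL.le hxp.le, ← Real.rpow_mul hx.1.le, abs_of_nonpos h, mul_comm]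
      ring_nf
  calc logApprox c s p x
      ≤ x ^ (-(c * p)) * (x ^ (-(|s| * p)) * (-Real.log x) ^ s) :=
        mul_le_mul_of_nonneg_left key (Real.rpow_nonneg hx.1.le _)
    _ = x ^ (-((c + |s|) * p)) * (-Real.log x) ^ s := by
        rw [← mul_assoc, ← Real.rpow_add hx.1]
        ring_nf
    _ ≤ x ^ (-(1 / 2) : ℝ) * (-Real.log x) ^ s :=
        mul_le_mul_of_nonneg_right
          (Real.rpow_le_rpow_of_exponent_ge hx.1 hx.2.le (neg_le_neg hcp))
          (Real.rpow_nonneg hL.le _)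

lemma tendsto_logApprox (c s : ℝ) {x : ℝ} (hx : x ∈ Set.Ioo (0 : ℝ) 1) :
    Tendsto (fun p => logApprox c s p x) (nhdsWithin 0 (Set.Ioi 0))
      (nhds ((-Real.log x) ^ s)) := by
  have hL : 0 < -Real.log x := neg_pos.mpr (Real.log_neg hx.1 hx.2)
  have h1 : Tendsto (fun p : ℝ => x ^ (-(c * p))) (nhdsWithin 0 (Set.Ioi 0)) (nhds 1) := by
    have h : Continuous fun p : ℝ => x ^ (-(c * p)) :=
      Continuous.rpow continuous_const (by fun_prop) fun _ => Or.inl hx.1.ne'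
    simpa using (h.tendsto 0).mono_left nhdsWithin_le_nhds
  have h2 : Tendsto (fun p : ℝ => p⁻¹ * (1 - x ^ p)) (nhdsWithin 0 (Set.Ioi 0))
      (nhds (-Real.log x)) := by
    refine (tendsto_rpow_sub_one_log hx.1).neg.congr fun p => ?_
    ring
  simpa [logApprox] using h1.mul (h2.rpow_const (Or.inl hL.ne'))

/-- Integrals of bounded functions against `logApprox` converge as `p → 0+`. -/
lemma tendsto_integral_mul_logApprox {c s : ℝ} (hs : -1 < s) {h : ℝ → ℂ}
    (hm : Measurable h) {K : ℝ} (hK : ∀ x ∈ Set.Ioo (0 : ℝ) 1, ‖h x‖ ≤ K) :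
    Tendsto (fun p => ∫ x in Set.Ioo (0 : ℝ) 1, h x * (logApprox c s p x : ℂ))
      (nhdsWithin 0 (Set.Ioi 0))
      (nhds (∫ x in Set.Ioo (0 : ℝ) 1, h x * (((-Real.log x) ^ s : ℝ) : ℂ))) := by
  refine tendsto_integral_filter_of_dominated_convergence
    (fun x => K * (x ^ (-(1 / 2) : ℝ) * (-Real.log x) ^ s)) ?_ ?_ ?_ ?_
  · refine Eventually.of_forall fun p => Measurable.aestronglyMeasurable ?_
    exact hm.mul (Complex.measurable_ofReal.comp (measurable_logApprox c s p))
  · have hsmall : ∀ᶠ p : ℝ in nhdsWithin 0 (Set.Ioi 0), (c + |s|) * p < 1 / 2 := by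
      have h : Continuous fun p : ℝ => (c + |s|) * p := by fun_prop
      exact ((h.tendsto 0).mono_left nhdsWithin_le_nhds).eventually_lt_const (by simp)
    filter_upwards [hsmall, self_mem_nhdsWithin] with p hp hp0
    refine (ae_restrict_iff' measurableSet_Ioo).mpr (Eventually.of_forall fun x hx => ?_)
    rw [norm_mul, Complex.norm_real, Real.norm_of_nonneg (logApprox_nonneg hp0 hx)]
    exact mul_le_mul (hK x hx) (logApprox_le hp0 hp.le hx) (logApprox_nonneg hp0 hx)
      ((norm_nonneg _).trans (hK x hx))
  · exact (integrableOn_rpow_mul_neg_log_rpow (by norm_num) hs).const_mul K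
  · refine (ae_restrict_iff' measurableSet_Ioo).mpr (Eventually.of_forall fun x hx => ?_)
    exact ((Complex.continuous_ofReal.tendsto _).comp (tendsto_logApprox c s hx)).const_mul _

lemma norm_exp_I_mul_sub_one_sub_le (y : ℝ) :
    ‖Complex.exp (Complex.I * y) - 1 - Complex.I * y‖ ≤ 3 * y ^ 2 := by
  have hn : ‖Complex.I * (y : ℂ)‖ = |y| := by simp
  rcases le_total |y| 1 with h | h
  · have := Complex.norm_exp_sub_one_sub_id_le (x := Complex.I * y) (hn.le.trans h)
    rw [hn, sq_abs] at this
    nlinarith [sq_nonneg y]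
  · calc ‖Complex.exp (Complex.I * y) - 1 - Complex.I * y‖
        ≤ ‖Complex.exp (Complex.I * y)‖ + ‖(1 : ℂ)‖ + ‖Complex.I * (y : ℂ)‖ :=
          (norm_sub_le _ _).trans (by gcongr; exact norm_sub_le _ _)
      _ = 1 + 1 + |y| := by rw [Complex.norm_exp_I_mul_ofReal, norm_one, hn]
      _ ≤ 3 * y ^ 2 := by
          rw [← sq_abs y]
          nlinarith

/-- The compensated exponential divided by `x ^ 2`. -/
noncomputable def compensatedKernel (t x : ℝ) : ℂ :=
  (Complex.exp (Complex.I * t * x) - 1 - Complex.I * t * x) * ((x ^ (-2 : ℝ) : ℝ) : ℂ)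

lemma measurable_compensatedKernel (t : ℝ) : Measurable (compensatedKernel t) := by
  unfold compensatedKernel
  fun_prop

lemma norm_compensatedKernel_le (t : ℝ) {x : ℝ} (hx : 0 < x) :
    ‖compensatedKernel t x‖ ≤ 3 * t ^ 2 := by
  have h := norm_exp_I_mul_sub_one_sub_le (t * x)
  push_cast at h
  rw [← mul_assoc] at h
  have hx2 : x ^ (-2 : ℝ) = (x ^ 2)⁻¹ := by
    rw [Real.rpow_neg hx.le, Real.rpow_two]
  rw [compensatedKernel, norm_mul, Complex.norm_real, hx2,
    Real.norm_of_nonneg (by positivity), ← div_eq_mul_inv, div_le_iff₀ (by positivity)]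
  linarith

/-- In codimension `b`, the Lévy density is a positive multiple of `x ^ (-2)` times
`logApprox`. -/
lemma exists_levyDensity_eq {b k : ℕ} (hb : 1 ≤ b) (hk : 1 < k) :
    ∃ C : ℝ, 0 < C ∧ ∀ x ∈ Set.Ioo (0 : ℝ) 1,
      levyDensity (k + b) k x =
        C * (x ^ (-2 : ℝ) * logApprox (b / 2) (b / 2 - 1) (2 / ((k : ℝ) - 1)) x) := by
  have hm : (0 : ℝ) < (k : ℝ) - 1 := by
    rw [sub_pos]
    exact_mod_cast hk
  have hb' : (0 : ℝ) < b := by exact_mod_cast hb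
  have hp : 0 < 2 / ((k : ℝ) - 1) := by positivity
  have hG : 0 < Real.Gamma ((b : ℝ) / 2) := Real.Gamma_pos_of_pos (by positivity)
  refine ⟨2 * Real.pi ^ ((b : ℝ) / 2) / Real.Gamma ((b : ℝ) / 2) / ((k : ℝ) - 1) *
    (2 / ((k : ℝ) - 1)) ^ ((b : ℝ) / 2 - 1), by positivity, fun x hx => ?_⟩
  have h1 : 0 ≤ 1 - x ^ (2 / ((k : ℝ) - 1)) :=
    sub_nonneg.mpr (Real.rpow_le_one hx.1.le hx.2.le hp.le)
  have he : -1 - ((k : ℝ) + b - 1) / ((k : ℝ) - 1) =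
      -2 + -((b : ℝ) / 2 * (2 / ((k : ℝ) - 1))) := by
    field_simp
    ring
  have hpow : (1 - x ^ (2 / ((k : ℝ) - 1))) ^ ((b : ℝ) / 2 - 1) =
      (2 / ((k : ℝ) - 1)) ^ ((b : ℝ) / 2 - 1) *
        ((2 / ((k : ℝ) - 1))⁻¹ * (1 - x ^ (2 / ((k : ℝ) - 1)))) ^ ((b : ℝ) / 2 - 1) := by
    rw [← Real.mul_rpow hp.le (mul_nonneg (inv_nonneg.mpr hp.le) h1), mul_inv_cancel_left₀ hp.ne']
  rw [levyDensity, logApprox]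
  push_cast
  rw [add_sub_cancel_left, he, Real.rpow_add hx.1, hpow]
  ring

/-- The normalised Lévy exponent in terms of `logApprox`. -/
lemma levyExponent_eq {b k : ℕ} (hb : 1 ≤ b) (hk : 1 < k) (t : ℝ) :
    ((sigmaSqHyp (k + b) k : ℂ))⁻¹ *
        ∫ x in Set.Ioo (0 : ℝ) 1,
          (Complex.exp (Complex.I * t * x) - 1 - Complex.I * t * x) *
            (levyDensity (k + b) k x : ℂ) =
      (∫ x in Set.Ioo (0 : ℝ) 1,
        1 * (logApprox (b / 2) (b / 2 - 1) (2 / ((k : ℝ) - 1)) x : ℂ))⁻¹ *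
      ∫ x in Set.Ioo (0 : ℝ) 1,
        compensatedKernel t x * (logApprox (b / 2) (b / 2 - 1) (2 / ((k : ℝ) - 1)) x : ℂ) := by
  obtain ⟨C, hC, h⟩ := exists_levyDensity_eq hb hk
  have hσ : (sigmaSqHyp (k + b) k : ℂ) = C * ∫ x in Set.Ioo (0 : ℝ) 1,
      1 * (logApprox (b / 2) (b / 2 - 1) (2 / ((k : ℝ) - 1)) x : ℂ) := by
    rw [sigmaSqHyp, ← integral_complex_ofReal, ← integral_const_mul]
    refine setIntegral_congr_fun measurableSet_Ioo fun x hx => ?_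
    have hx2 : x ^ 2 * x ^ (-2 : ℝ) = 1 := by
      rw [Real.rpow_neg hx.1.le, Real.rpow_two, mul_inv_cancel₀ (pow_pos hx.1 2).ne']
    have : x ^ 2 * levyDensity (k + b) k x =
        C * logApprox (b / 2) (b / 2 - 1) (2 / ((k : ℝ) - 1)) x := by
      rw [h x hx]
      linear_combination C * logApprox (b / 2) (b / 2 - 1) (2 / ((k : ℝ) - 1)) x * hx2
    simp [this]
  have hI : ∫ x in Set.Ioo (0 : ℝ) 1,
      (Complex.exp (Complex.I * t * x) - 1 - Complex.I * t * x) *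
        (levyDensity (k + b) k x : ℂ) = C * ∫ x in Set.Ioo (0 : ℝ) 1,
      compensatedKernel t x * (logApprox (b / 2) (b / 2 - 1) (2 / ((k : ℝ) - 1)) x : ℂ) := by
    rw [← integral_const_mul]
    refine setIntegral_congr_fun measurableSet_Ioo fun x hx => ?_
    simp only [h x hx, compensatedKernel]
    push_cast
    ring
  have hC' : (C : ℂ) ≠ 0 := by exact_mod_cast hC.ne'
  rw [hσ, hI, mul_inv]
  field_simp

lemma charFun_eq_charFn (μ : Measure ℝ) (t : ℝ) : charFun μ t = charFn μ t := by
  rw [charFun_apply_real, charFn]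
  congr 1 with x
  ring_nf

/-- Fixed-codimension limit: if `(d_n,k_n)` is admissible with constant codimension
`d_n − k_n = b ≥ 1` and `d_n → ∞`, then the probability measures `μ n` with characteristic
function `exp(σ_{d_n,k_n}^{-2} ∫_0^1 (e^{itx} − 1 − itx) f_{d_n,k_n}(x) dx)` converge weakly
to the probability measure `μb` with characteristic function
`exp(Γ(b/2)⁻¹ ∫_0^1 (e^{itx} − 1 − itx) x^{−2} (−log x)^{(b−2)/2} dx)`. -/
theorem hyperbolic_fixed_codimension_limit (b : ℕ) (hb : 1 ≤ b) (d k : ℕ → ℕ)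
    (hadm : ∀ n, 1 ≤ k n ∧ k n + 1 ≤ d n ∧ d n + 1 < 2 * k n)
    (hcodim : ∀ n, d n = k n + b)
    (hd : Tendsto d atTop atTop)
    (μ : ℕ → ProbabilityMeasure ℝ)
    (hchar : ∀ n, ∀ t : ℝ, charFn (μ n) t =
      Complex.exp (((sigmaSqHyp (d n) (k n) : ℂ))⁻¹ *
        ∫ x in Set.Ioo (0 : ℝ) 1,
          (Complex.exp (Complex.I * t * x) - 1 - Complex.I * t * x) *
            (levyDensity (d n) (k n) x : ℂ)))
    (μb : ProbabilityMeasure ℝ)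
    (hcharb : ∀ t : ℝ, charFn μb t =
      Complex.exp (((Real.Gamma ((b : ℝ) / 2) : ℂ))⁻¹ *
        ∫ x in Set.Ioo (0 : ℝ) 1,
          (Complex.exp (Complex.I * t * x) - 1 - Complex.I * t * x) *
            ((x ^ (-2 : ℝ) * (-Real.log x) ^ (((b : ℝ) - 2) / 2) : ℝ) : ℂ))) :
    Tendsto μ atTop (nhds μb) := by
  rw [ProbabilityMeasure.tendsto_iff_tendsto_charFun]
  intro t
  simp only [charFun_eq_charFn, hcharb t]
  have hk : ∀ n, 1 < k n := fun n => by
    have := hadm n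
    omega
  have hs : (-1 : ℝ) < (b : ℝ) / 2 - 1 := by
    have : (0 : ℝ) < b := by exact_mod_cast hb
    linarith
  have hkt : Tendsto k atTop atTop := by
    refine tendsto_atTop_mono (fun n => ?_) ((tendsto_sub_atTop_nat b).comp hd)
    simp [hcodim n]
  have hp : Tendsto (fun n => 2 / ((k n : ℝ) - 1)) atTop (nhdsWithin 0 (Set.Ioi 0)) := by
    refine tendsto_nhdsWithin_iff.mpr ⟨?_, Eventually.of_forall fun n => ?_⟩
    · exact (tendsto_atTop_add_const_right _ (-1)
        (tendsto_natCast_atTop_atTop.comp hkt)).const_div_atTop 2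
    · have : (1 : ℝ) < k n := by exact_mod_cast hk n
      exact div_pos two_pos (sub_pos.mpr this)
  have hden := (tendsto_integral_mul_logApprox (c := b / 2) hs (h := fun _ => 1)
    measurable_const (K := 1) (by simp)).comp hp
  have hnum := (tendsto_integral_mul_logApprox (c := b / 2) hs
    (measurable_compensatedKernel t) fun x hx => norm_compensatedKernel_le t hx.1).comp hp
  have hΓ : ∫ x in Set.Ioo (0 : ℝ) 1, 1 * (((-Real.log x) ^ ((b : ℝ) / 2 - 1) : ℝ) : ℂ) =
      (Real.Gamma ((b : ℝ) / 2) : ℂ) := by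
    simp only [one_mul]
    rw [integral_complex_ofReal, integral_neg_log_rpow hs, sub_add_cancel]
  have hlim : ∫ x in Set.Ioo (0 : ℝ) 1, compensatedKernel t x *
      (((-Real.log x) ^ ((b : ℝ) / 2 - 1) : ℝ) : ℂ) = ∫ x in Set.Ioo (0 : ℝ) 1,
      (Complex.exp (Complex.I * t * x) - 1 - Complex.I * t * x) *
        ((x ^ (-2 : ℝ) * (-Real.log x) ^ (((b : ℝ) - 2) / 2) : ℝ) : ℂ) := by
    refine setIntegral_congr_fun measurableSet_Ioo fun x _ => ?_
    simp only [compensatedKernel, sub_div, div_self (two_ne_zero' ℝ)]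
    push_cast
    ring
  rw [hΓ] at hden
  rw [hlim] at hnum
  have hΓ0 : (Real.Gamma ((b : ℝ) / 2) : ℂ) ≠ 0 := by
    exact_mod_cast (Real.Gamma_pos_of_pos (by linarith)).ne'
  refine ((Complex.continuous_exp.tendsto _).comp ((hden.inv₀ hΓ0).mul hnum)).congr fun n => ?_
  rw [hchar n t, hcodim n, levyExponent_eq hb (hk n) t]
  rfl
end
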